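/- Let a(n) be the cubic partition function. Then for every nonnegative integer n, a(49n+29) ≡ 0 (mod 7). -/

import Mathlib

/-- The cubic partition function: number of pairs of partitions (λ, μ) with
|λ| + |μ| = n where all parts of μ are even. -/
def cubicPartition (n : ℕ) : ℕ :=
  ∑ j ∈ Finset.range (n + 1),
    Fintype.card (Nat.Partition j) *
      Fintype.card {μ : Nat.Partition (n - j) // ∀ i ∈ μ.parts, Even i}

section

open PowerSeries

namespace CubicPartition

instance fact_prime_seven : Fact (Nat.Prime 7) := ⟨by norm_num⟩

section Theta
variable {R : Type*} [CommRing R]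

/-- The derivation `θ = X · d/dX` of a ring of power series. -/
noncomputable def theta : Derivation R R⟦X⟧ R⟦X⟧ := (X : R⟦X⟧) • derivative R

theorem theta_apply (f : R⟦X⟧) : theta f = X * derivative R f := rfl

theorem coeff_theta (f : R⟦X⟧) (n : ℕ) : coeff n (theta f) = n * coeff n f := by
  rw [theta_apply]
  cases n with
  | zero => simp
  | succ n => rw [coeff_succ_X_mul, coeff_derivative]; push_cast; ring

theorem theta_X_pow (n : ℕ) : theta (X ^ n : R⟦X⟧) = n * (X : R⟦X⟧) ^ n := by
  ext m
  rw [coeff_theta, ← map_natCast (C (R := R)), coeff_C_mul, coeff_X_pow]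
  split_ifs with h <;> simp [h]

theorem theta_pow (f : R⟦X⟧) (n : ℕ) : theta (f ^ n) = n * f ^ (n - 1) * theta f := by
  rw [Derivation.leibniz_pow, smul_eq_mul, nsmul_eq_mul, mul_assoc]

theorem theta_mul (f g : R⟦X⟧) : theta (f * g) = f * theta g + theta f * g := by
  rw [Derivation.leibniz, smul_eq_mul, smul_eq_mul, mul_comm g]

theorem theta_natCast (n : ℕ) : theta (n : R⟦X⟧) = 0 := by simp

theorem X_pow_dvd_theta {n : ℕ} {f : R⟦X⟧} (h : X ^ n ∣ f) : X ^ n ∣ theta f := by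
  rw [X_pow_dvd_iff] at h ⊢
  intro m hm
  rw [coeff_theta, h m hm, mul_zero]

theorem theta_expand (d : ℕ) (hd : d ≠ 0) (f : R⟦X⟧) :
    theta (expand d hd f) = d * expand d hd (theta f) := by
  ext m
  rw [coeff_theta, ← map_natCast (C (R := R)), coeff_C_mul, coeff_expand, coeff_expand]
  split_ifs with h
  · obtain ⟨k, rfl⟩ := h
    rw [Nat.mul_div_cancel_left _ (Nat.pos_of_ne_zero hd), coeff_theta]
    push_cast; ring
  · simp

theorem eq_zero_of_forall_X_pow_dvd {f : R⟦X⟧} (h : ∀ n, X ^ n ∣ f) : f = 0 := by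
  ext n
  exact X_pow_dvd_iff.mp (h (n + 1)) n n.lt_succ_self

end Theta

instance charP_powerSeries : CharP (ZMod 7)⟦X⟧ 7 :=
  charP_of_injective_ringHom (f := (C : ZMod 7 →+* (ZMod 7)⟦X⟧)) C_injective 7

theorem seven_eq_zero : (7 : (ZMod 7)⟦X⟧) = 0 := CharP.ofNat_eq_zero _ 7

theorem theta_theta_theta_of_theta_eq {R : Type*} [CommRing R] {f l : R⟦X⟧}
    (h : theta f = l * f) :
    theta (theta (theta f)) = (theta (theta l) + 3 * l * theta l + l ^ 3) * f := by
  simp only [h, theta_mul, map_add]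
  ring

theorem level_one_relation {l d : (ZMod 7)⟦X⟧} (hd : theta d = -(l * d))
    (h₁ : theta (theta l) + 3 * l * theta l + l ^ 3 = -1 - d)
    (h₂ : theta (theta (3 * l)) + 3 * (3 * l) * theta (3 * l) + (3 * l) ^ 3 = 1) :
    l ^ 3 * ((l ^ 3 + 1 + d) ^ 2 - 4 * d) = 0 := by
  have h3 : theta (3 : (ZMod 7)⟦X⟧) = 0 := theta_natCast 3
  have e : l * theta l = l ^ 3 + 1 - d := by
    simp only [theta_mul, h3, map_add, map_zero] at h₂
    linear_combination 2 * h₂ - 6 * h₁ + (-5 * l * theta l - 7 * l ^ 3 + 1 + d) * seven_eq_zero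
  have e' := congrArg theta e
  simp only [theta_mul, map_add, map_sub, theta_pow, hd, Derivation.map_one_eq_zero] at e'
  push_cast at e'
  generalize theta (theta l) = m at *
  generalize theta l = k at *
  grind

theorem exists_level_one {e : (ZMod 7)⟦X⟧} (h₀ : constantCoeff e = 1) (h₁ : coeff 1 e = -1)
    (hp : theta (theta (theta (X ^ 5 * e))) = -(X ^ 5 * e) - X ^ 7 * e ^ 49)
    (hj : theta (theta (theta (X * e ^ 3))) = X * e ^ 3) :
    ∃ a : (ZMod 7)⟦X⟧, constantCoeff a = 1 ∧ X * e ^ 24 = 1 - a ^ 3 ∧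
      theta e = 5 * (a ^ 2 - 1) * e ∧ theta a = 2 * (1 - a ^ 3) := by
  have he : e * e⁻¹ = 1 := PowerSeries.mul_inv_cancel e (by rw [h₀]; exact one_ne_zero)
  have he0 : e ≠ 0 := left_ne_zero_of_mul_eq_one he
  have hX0 : (X : (ZMod 7)⟦X⟧) ≠ 0 := X_ne_zero
  have hX : theta (X : (ZMod 7)⟦X⟧) = X := by simpa using theta_X_pow (R := ZMod 7) 1
  obtain ⟨l, hl⟩ : ∃ l : (ZMod 7)⟦X⟧, theta e = (l - 5) * e :=
    ⟨5 + theta e * e⁻¹, by linear_combination (-theta e) * he⟩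
  obtain ⟨r, hr⟩ : X ∣ l - 5 := by
    have := congrArg constantCoeff hl
    rw [theta_apply] at this
    simpa [h₀, X_dvd_iff] using this.symm
  have hr0 : constantCoeff r = -1 := by
    have := congrArg (coeff 1) hl
    rw [coeff_theta, hr, h₁, mul_assoc, show (1 : ℕ) = 0 + 1 from rfl, coeff_succ_X_mul] at this
    simpa [h₀] using this.symm
  have hl' : l = 5 + X * r := by linear_combination hr
  have hη : theta (X ^ 5 * e) = l * (X ^ 5 * e) := by
    rw [theta_mul, theta_X_pow, hl]; push_cast; ring
  have hu : theta (X * e ^ 3) = (3 * l) * (X * e ^ 3) := by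
    rw [theta_mul, hX, theta_pow, hl]; push_cast
    linear_combination (-2 * X * e ^ 3) * seven_eq_zero
  have hΔ : theta (X * e ^ 24) = 3 * l * (X * e ^ 24) := by
    rw [theta_mul, hX, theta_pow, hl]; push_cast
    linear_combination (-17 * X * e ^ 24 + 3 * l * X * e ^ 24) * seven_eq_zero
  have hD : theta ((X * e ^ 24) ^ 2) = -(l * (X * e ^ 24) ^ 2) := by
    rw [theta_pow, hΔ]; push_cast
    linear_combination (l * (X * e ^ 24) ^ 2) * seven_eq_zero
  have e₁ : theta (theta l) + 3 * l * theta l + l ^ 3 = -1 - (X * e ^ 24) ^ 2 := by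
    rw [theta_theta_theta_of_theta_eq hη] at hp
    refine mul_right_cancel₀ (mul_ne_zero (pow_ne_zero 5 hX0) he0) (hp.trans ?_)
    ring
  have e₂ : theta (theta (3 * l)) + 3 * (3 * l) * theta (3 * l) + (3 * l) ^ 3 = 1 := by
    rw [theta_theta_theta_of_theta_eq hu] at hj
    refine mul_right_cancel₀ (mul_ne_zero hX0 (pow_ne_zero 3 he0)) (hj.trans ?_)
    ring
  have hl0 : constantCoeff l = 5 := by
    rw [hl', map_add, map_mul, constantCoeff_X, zero_mul, add_zero]; exact map_ofNat _ 5
  have hlne : l ≠ 0 := by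
    rintro rfl
    revert hl0
    simp only [map_zero]
    decide
  set d := X * e ^ 24 with hd
  have h := level_one_relation hD e₁ e₂
  have hne : l ^ 3 + 1 + d ^ 2 + 2 * d ≠ 0 := by
    have : l ^ 3 + 1 + d ^ 2 + 2 * d
        = X * (75 * r + 15 * X * r ^ 2 + X ^ 2 * r ^ 3 + X * e ^ 48 + 2 * e ^ 24) := by
      rw [hl', hd]; linear_combination 18 * seven_eq_zero
    rw [this]
    refine mul_ne_zero hX0 fun h' ↦ ?_
    have := congrArg constantCoeff h'
    simp [hr0, h₀] at this
    revert this
    decide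
  have hcube : l ^ 3 = -(1 - d) ^ 2 := by
    have h' : (l ^ 3 + 1 + d ^ 2 + 2 * d) * (l ^ 3 + 1 + d ^ 2 - 2 * d) = 0 := by
      linear_combination (mul_eq_zero.mp h).resolve_left (pow_ne_zero 3 hlne)
    linear_combination (mul_eq_zero.mp h').resolve_left hne
  have hli : l * l⁻¹ = 1 := PowerSeries.mul_inv_cancel l (by rw [hl0]; decide)
  obtain ⟨a, hal⟩ : ∃ a, a * l = 5 * (1 - d) :=
    ⟨5 * (1 - d) * l⁻¹, by linear_combination 5 * (1 - d) * hli⟩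
  have hd0 : constantCoeff d = 0 := by simp [hd]
  have ha0 : constantCoeff a = 1 := by
    have := congrArg constantCoeff hal
    rw [map_mul, map_mul, map_sub, hl0, hd0, map_ofNat, map_one, sub_zero, mul_one] at this
    exact mul_right_cancel₀ (by decide) (this.trans (one_mul _).symm)
  have hane : a ≠ 0 := by rintro h; simp [h] at ha0
  have ha2 : a ^ 2 = 3 * l := by
    refine mul_right_cancel₀ (pow_ne_zero 2 hlne) ?_
    linear_combination (a * l + 5 * (1 - d)) * hal - 3 * hcube + 4 * (1 - d) ^ 2 * seven_eq_zero
  have ha3 : d = 1 - a ^ 3 := by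
    refine mul_right_cancel₀ hlne ?_
    linear_combination a * l * ha2 + 3 * l * hal + 2 * l * (1 - d) * seven_eq_zero
  have hta : theta a = 2 * (1 - a ^ 3) := by
    have := congrArg theta ha3
    rw [hΔ, map_sub, theta_pow, Derivation.map_one_eq_zero] at this
    push_cast at this
    refine mul_left_cancel₀ (pow_ne_zero 2 hane) ?_
    linear_combination -2 * this + 2 * a ^ 2 * ha3 - 2 * d * ha2 + a ^ 2 * theta a * seven_eq_zero
  refine ⟨a, ha0, ha3, ?_, hta⟩
  rw [hl]
  linear_combination -5 * e * ha2 - 2 * l * e * seven_eq_zero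

/-- The cofactor of the modular equation of degree two in the relation between the weight four
Eisenstein series at `q` and `q ^ 2` modulo `7` that comes from the theta series. -/
noncomputable def cofactor (a b : (ZMod 7)⟦X⟧) : (ZMod 7)⟦X⟧ :=
  - a ^ 9 + 3 * a ^ 8 * b + 3 * a ^ 7 * b ^ 2 - 2 * a ^ 6 * b ^ 3 + a ^ 6 + 2 * a ^ 5 * b ^
      4 - a ^ 5 * b + a ^ 4 * b ^ 5 + 2 * a ^ 3 * b ^ 6 + 3 * a ^ 3 + a ^ 2 * b ^ 7 + 2 *
      a ^ 2 * b + a * b ^ 8 + a * b ^ 5 + a * b ^ 2 - 3 * b ^ 9 + b ^ 6 + 2 * b ^ 3 - 3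

theorem cofactor_one_add (s t : (ZMod 7)⟦X⟧) : ∃ p r : (ZMod 7)⟦X⟧,
    cofactor (1 + s) (1 + t) = s ^ 2 * p + t * r ∧
      (constantCoeff s = 0 → constantCoeff t = 0 → constantCoeff p = -3 ∧ constantCoeff r = 1) := by
  refine ⟨- s ^ 7 + 3 * s ^ 6 * t + s ^ 6 + 3 * s ^ 5 * t ^ 2 + 2 * s ^ 5 * t - 2 * s ^ 5 - 2 * s ^
      4 * t ^ 3 + s ^ 4 * t ^ 2 + s ^ 4 * t - s ^ 4 + 2 * s ^ 3 * t ^ 4 + 3 * s ^ 3 * t ^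
      3 - 3 * s ^ 3 * t ^ 2 - s ^ 3 * t + 2 * s ^ 3 + s ^ 2 * t ^ 5 + s ^ 2 * t ^ 4 - s ^
      2 * t ^ 3 + s ^ 2 * t ^ 2 - s ^ 2 * t - 2 * s ^ 2 + 2 * s * t ^ 6 + 2 * s * t ^ 5 +
      s * t ^ 3 + 3 * s * t - s + t ^ 7 - t ^ 6 - t ^ 3 - 2 * t ^ 2 - t - 3,
    s * t ^ 7 + 3 * s * t ^ 6 - s * t ^ 5 - s * t ^ 4 - s * t ^ 3 + 2 * s * t ^ 2 - 3 * s * t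
      - 3 * t ^ 8 + 2 * t ^ 7 - t ^ 6 + 3 * t ^ 5 - t ^ 4 + t ^ 3 - 3 * t ^ 2 + t + 1,
    ?_, fun hs ht ↦ by simp [hs, ht]; rfl⟩
  unfold cofactor
  grind

theorem cofactor_ne_zero {a b : (ZMod 7)⟦X⟧} (ha : constantCoeff a = 1) (ha₁ : coeff 1 a = 2)
    (hb : expand 2 two_ne_zero a = b) : cofactor a b ≠ 0 := by
  obtain ⟨s, hs⟩ : X ∣ a - 1 := by simp [X_dvd_iff, ha]
  have hs' : a = 1 + X * s := by linear_combination hs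
  have ht' : b = 1 + X ^ 2 * expand 2 two_ne_zero s := by
    rw [← hb, hs', map_add, map_one, map_mul, expand_X]
  have hs0 : constantCoeff s = 2 := by
    have h : coeff 1 (X * s) = constantCoeff s := by simp
    rw [hs', map_add, h] at ha₁
    simpa [coeff_one] using ha₁
  have ht0 : constantCoeff (expand 2 two_ne_zero s) = 2 := by rw [constantCoeff_expand, hs0]
  generalize expand 2 two_ne_zero s = t at ht' ht0
  obtain ⟨p, r, h, hpr⟩ := cofactor_one_add (X * s) (X ^ 2 * t)
  obtain ⟨hp, hr⟩ := hpr (by simp) (by simp)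
  rw [hs', ht', h, show (X * s) ^ 2 * p + X ^ 2 * t * r = X ^ 2 * (s ^ 2 * p + t * r) by ring]
  refine mul_ne_zero (pow_ne_zero 2 X_ne_zero) fun h ↦ ?_
  have := congrArg constantCoeff h
  simp only [map_add, map_mul, map_pow, map_zero, hs0, ht0, hp, hr] at this
  revert this
  decide

theorem cofactor_mul (a b : (ZMod 7)⟦X⟧) : cofactor a b * ((a - 3 * b) * (a + 3 * b) ^ 2 - 3) =
    (1 - (-2 * a ^ 6 - a ^ 3 + b ^ 6 - 3 * b ^ 3 - 2)
      - 3 * (3 * a ^ 2 - 3 * b ^ 2) * (2 * a ^ 4 - 2 * a + 3 * b ^ 4 - 3 * b)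
      - (3 * a ^ 2 - 3 * b ^ 2) ^ 3) * (1 - b ^ 3) ^ 2 - (1 - a ^ 3) ^ 4 := by
  unfold cofactor
  grind

theorem level_two_relation {a b l α : (ZMod 7)⟦X⟧} (ha : theta a = 2 * (1 - a ^ 3))
    (hb : theta b = 4 * (1 - b ^ 3)) (hl : l = 3 * a ^ 2 - 3 * b ^ 2)
    (hα : α * (1 - b ^ 3) ^ 2 = (1 - a ^ 3) ^ 4)
    (h : theta (theta l) + 3 * l * theta l + l ^ 3 = 1 - α) :
    cofactor a b * ((a - 3 * b) * (a + 3 * b) ^ 2 - 3) = 0 := by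
  have h3 : theta (3 : (ZMod 7)⟦X⟧) = 0 := theta_natCast 3
  have h2 : theta (2 : (ZMod 7)⟦X⟧) = 0 := theta_natCast 2
  have hl₁ : theta l = 2 * a ^ 4 - 2 * a + 3 * b ^ 4 - 3 * b := by
    simp only [hl, map_sub, theta_mul, theta_pow, ha, hb, h3]
    push_cast
    grind
  have hl₂ : theta (theta l) = -2 * a ^ 6 - a ^ 3 + b ^ 6 - 3 * b ^ 3 - 2 := by
    simp only [hl₁, map_sub, map_add, theta_mul, theta_pow, ha, hb, h3, h2]
    push_cast
    grind
  have hN : (1 - theta (theta l) - 3 * l * theta l - l ^ 3) * (1 - b ^ 3) ^ 2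
      - (1 - a ^ 3) ^ 4 = 0 := by
    linear_combination hα - (1 - b ^ 3) ^ 2 * h
  rw [hl₂, hl₁, hl] at hN
  rw [cofactor_mul, hN]

theorem theta_weight_two {a b : (ZMod 7)⟦X⟧} (ha : theta a = 2 * (1 - a ^ 3))
    (hb : theta b = 4 * (1 - b ^ 3)) (hab : (a - 3 * b) * (a + 3 * b) ^ 2 = 3) :
    ∃ A I : (ZMod 7)⟦X⟧, A * I = 1 ∧ a = 6 * A ^ 2 + 2 * I ∧ b = 5 * A ^ 2 + 3 * I ∧
      theta A = I - A ^ 5 := by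
  have h2 : theta (2 : (ZMod 7)⟦X⟧) = 0 := theta_natCast 2
  refine ⟨2 * b ^ 2 - a ^ 2, 2 * (a + 3 * b), ?_, ?_, ?_, ?_⟩
  · grind
  · grind
  · grind
  · simp only [map_sub, theta_mul, theta_pow, ha, hb, h2]
    push_cast
    grind

theorem theta_pow_six {A I w : (ZMod 7)⟦X⟧} (hAI : A * I = 1) (hA : theta A = I - A ^ 5)
    (hw : theta w = (5 * I ^ 2 + 3 * A ^ 4) * w) :
    theta (theta (theta (theta (theta (theta (w ^ 6)))))) =
      w ^ 6 * (1 + 2 * A ^ 12 + 5 * A ^ 18) := by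
  have hI : theta I = -I ^ 3 + A ^ 3 := by
    have := congrArg theta hAI
    rw [theta_mul, hA, Derivation.map_one_eq_zero] at this
    grind
  have h2 : theta (2 : (ZMod 7)⟦X⟧) = 0 := theta_natCast 2
  have h3 : theta (3 : (ZMod 7)⟦X⟧) = 0 := theta_natCast 3
  have h4 : theta (4 : (ZMod 7)⟦X⟧) = 0 := theta_natCast 4
  have hv : theta (w ^ 6) = w ^ 6 * (2 * I ^ 2 + 4 * A ^ 4) := by
    rw [theta_pow, hw]; push_cast; grind
  clear hw
  generalize w ^ 6 = v at *
  have e1 : theta (v * (2 * I ^ 2 + 4 * A ^ 4)) = v * A ^ 2 := by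
    simp only [theta_mul, map_add, theta_pow, hI, hA, hv, h2, h4]
    push_cast
    clear hA hI hv h2 h3 h4
    grind
  have e2 : theta (v * A ^ 2) = v * (4 + 2 * A ^ 6) := by
    simp only [theta_mul, theta_pow, hA, hv]
    push_cast
    clear hA hI hv h2 h3 h4
    grind
  have e3 : theta (v * (4 + 2 * A ^ 6)) = v * (I ^ 2 + 4 * A ^ 4 + 3 * A ^ 10) := by
    simp only [theta_mul, map_add, theta_pow, hA, hv, h2, h4]
    push_cast
    clear hA hI hv h2 h3 h4
    grind
  have e4 : theta (v * (I ^ 2 + 4 * A ^ 4 + 3 * A ^ 10)) =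
      v * (2 * A ^ 2 + A ^ 8 + 3 * A ^ 14) := by
    simp only [theta_mul, map_add, theta_pow, hI, hA, hv, h3, h4]
    push_cast
    clear hA hI hv h2 h3 h4
    grind
  have e5 : theta (v * (2 * A ^ 2 + A ^ 8 + 3 * A ^ 14)) = v * (1 + 2 * A ^ 12 + 5 * A ^ 18) := by
    simp only [theta_mul, map_add, theta_pow, hA, hv, h2, h3]
    push_cast
    clear hA hI hv h2 h3 h4
    grind
  rw [hv, e1, e2, e3, e4, e5]

theorem theta_theta_theta_mul_sq {A I w : (ZMod 7)⟦X⟧} (hAI : A * I = 1)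
    (hA : theta A = I - A ^ 5) (hw : theta w = (5 * I ^ 2 + 3 * A ^ 4) * w) :
    theta (theta (theta (w * A ^ 2))) = w * A ^ 2 := by
  have h4 : theta (4 : (ZMod 7)⟦X⟧) = 0 := theta_natCast 4
  have e1 : theta (w * A ^ 2) = w * A ^ 6 := by
    rw [theta_mul, hw, theta_pow, hA]; push_cast
    grind
  have e2 : theta (w * A ^ 6) = w * (4 * A ^ 4 + 4 * A ^ 10) := by
    rw [theta_mul, hw, theta_pow, hA]; push_cast
    grind
  rw [e1, e2]
  simp only [map_add, theta_mul, theta_pow, hA, h4, hw]; push_cast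
  grind

theorem theta_sixth_sub {e f φ F : (ZMod 7)⟦X⟧} (h₀ : constantCoeff e = 1) (h₁ : coeff 1 e = -1)
    (hp : theta (theta (theta (X ^ 5 * e))) = -(X ^ 5 * e) - X ^ 7 * e ^ 49)
    (hj : theta (theta (theta (X * e ^ 3))) = X * e ^ 3) (hf : expand 2 two_ne_zero e = f)
    (hφ : φ * f = e ^ 2) (hg : theta (theta (theta φ)) = φ - φ ^ 49) (hF : F * (e * f) = 1) :
    ∃ H : (ZMod 7)⟦X⟧, theta (theta (theta H)) = H ∧
      X ^ 6 * F - theta (theta (theta (theta (theta (theta (X ^ 6 * F)))))) = H ^ 7 := by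
  obtain ⟨a, ha0, hae, hθe, hθa⟩ := exists_level_one h₀ h₁ hp hj
  have he0 : e ≠ 0 := by rintro rfl; simp at h₀
  have hX0 : (X : (ZMod 7)⟦X⟧) ≠ 0 := X_ne_zero
  have hX : theta (X : (ZMod 7)⟦X⟧) = X := by simpa using theta_X_pow (R := ZMod 7) 1
  have hf0 : constantCoeff f = 1 := by rw [← hf, constantCoeff_expand, h₀]
  have hfne : f ≠ 0 := by rintro rfl; simp at hf0
  have hφne : φ ≠ 0 := by
    rintro rfl
    exact pow_ne_zero 2 he0 (by rw [← hφ, zero_mul])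
  have ha1 : coeff 1 a = 2 := by
    have h := congrArg (coeff 1) hθa
    rw [← hae, coeff_theta, ← map_ofNat (C (R := ZMod 7)), coeff_C_mul,
      show coeff 1 (X * e ^ 24) = constantCoeff (e ^ 24) by simp] at h
    simpa [h₀] using h
  obtain ⟨b, hb⟩ : ∃ b, expand 2 two_ne_zero a = b := ⟨_, rfl⟩
  have hbf : X ^ 2 * f ^ 24 = 1 - b ^ 3 := by
    have := congrArg (expand 2 two_ne_zero) hae
    simpa [hf, hb, expand_X] using this
  have hθb : theta b = 4 * (1 - b ^ 3) := by
    rw [← hb, theta_expand, hθa, map_mul, map_sub, map_one, map_pow, map_ofNat]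
    push_cast
    ring
  have hθf : theta f = (3 * b ^ 2 - 3) * f := by
    rw [← hf, theta_expand, hθe, map_mul, map_mul, map_sub, map_one, map_pow, map_ofNat, hb, hf]
    push_cast
    linear_combination (b ^ 2 - 1) * f * seven_eq_zero
  have hb0 : constantCoeff b = 1 := by rw [← hb, constantCoeff_expand, ha0]
  have hθφ : theta φ = (3 * a ^ 2 - 3 * b ^ 2) * φ := by
    have := congrArg theta hφ
    rw [theta_mul, theta_pow, hθf, hθe] at this
    push_cast at this
    refine mul_right_cancel₀ hfne ?_
    linear_combination this - 10 * (a ^ 2 - 1) * hφ + (a ^ 2 - 1) * φ * f * seven_eq_zero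
  have hα : φ ^ 48 * (1 - b ^ 3) ^ 2 = (1 - a ^ 3) ^ 4 := by
    rw [← hbf, ← hae]
    linear_combination X ^ 4 * congrArg (· ^ 48) hφ
  have hrel := level_two_relation hθa hθb rfl hα (by
    rw [theta_theta_theta_of_theta_eq hθφ] at hg
    refine mul_right_cancel₀ hφne (hg.trans ?_)
    ring)
  have hab := sub_eq_zero.mp ((mul_eq_zero.mp hrel).resolve_left (cofactor_ne_zero ha0 ha1 hb))
  obtain ⟨A, I, hAI, haA, hbA, hθA⟩ := theta_weight_two hθa hθb hab
  have hw : theta (X * (e * f)) = (5 * I ^ 2 + 3 * A ^ 4) * (X * (e * f)) := by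
    rw [theta_mul, theta_mul, hX, hθe, hθf, haA, hbA]
    linear_combination X * e * f * (36 * A ^ 4 + 30 * A ^ 2 * I + 6 * I ^ 2 - 1) * seven_eq_zero
  have hZ : X * (e * f) ^ 8 = 4 * ((2 * b - a) * (a - b)) := by
    have hcube : (X * (e * f) ^ 8) ^ 3 = (4 * ((2 * b - a) * (a - b))) ^ 3 := by
      trans (1 - a ^ 3) * (1 - b ^ 3)
      · rw [← hae, ← hbf]; ring
      · rw [haA, hbA]
        clear * - hAI
        grind
    have hz : coeff 1 (X * (e * f) ^ 8) = 1 := by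
      rw [show coeff 1 (X * (e * f) ^ 8) = constantCoeff ((e * f) ^ 8) by simp]
      simp [h₀, hf0]
    have hz' : coeff 1 (4 * ((2 * b - a) * (a - b))) = (1 : ZMod 7) := by
      have hb1 : coeff 1 b = 0 := by
        rw [← hb, coeff_expand_of_not_dvd]
        decide
      simp [← map_ofNat (C (R := ZMod 7)), coeff_one_mul, ha0, hb0, ha1, hb1]
      rfl
    generalize X * (e * f) ^ 8 = z at *
    generalize 4 * ((2 * b - a) * (a - b)) = z' at *
    have hne (k : ZMod 7) (hk : k ≠ 1) : z - C k * z' ≠ 0 := by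
      intro h
      have := congrArg (coeff 1) h
      rw [map_sub, coeff_C_mul, hz, hz', mul_one, map_zero, sub_eq_zero] at this
      exact hk this.symm
    have h : (z - z') * ((z - C 2 * z') * (z - C 4 * z')) = 0 := by
      rw [map_ofNat, map_ofNat]
      linear_combination hcube + (- z ^ 2 * z' + 2 * z * z' ^ 2 - z' ^ 3) * seven_eq_zero
    exact sub_eq_zero.mp ((mul_eq_zero.mp h).resolve_right
      (mul_ne_zero (hne 2 (by decide)) (hne 4 (by decide))))
  refine ⟨X * (e * f) * A ^ 2, theta_theta_theta_mul_sq hAI hθA hw, ?_⟩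
  have h6 := theta_pow_six hAI hθA hw
  have hinv : X ^ 6 * F * (e * f) ^ 7 = (X * (e * f)) ^ 6 := by
    linear_combination X ^ 6 * (e * f) ^ 6 * hF
  have h7 (g : (ZMod 7)⟦X⟧) : theta (g * (e * f) ^ 7) = theta g * (e * f) ^ 7 := by
    rw [theta_mul, theta_pow]
    push_cast
    linear_combination g * (e * f) ^ 6 * theta (e * f) * seven_eq_zero
  rw [← hinv, h7, h7, h7, h7, h7, h7] at h6
  refine mul_right_cancel₀ (pow_ne_zero 7 (mul_ne_zero he0 hfne)) ?_
  rw [sub_mul, h6, hinv]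
  have hZ' : X * (e * f) ^ 8 = 5 * I ^ 2 + 2 * A ^ 4 := by
    rw [hZ, haA, hbA]
    clear * - hAI
    grind
  linear_combination X ^ 6 * (e * f) ^ 6 * (-A ^ 14 * hZ'
      - 5 * A ^ 12 * (A * I + 1) * hAI - (A ^ 12 + A ^ 18) * seven_eq_zero)

theorem coeff_eq_zero_of_theta_theta_theta {H : (ZMod 7)⟦X⟧} (h : theta (theta (theta H)) = H)
    {m : ℕ} (hm : (m : ZMod 7) ^ 3 ≠ 1) : coeff m H = 0 := by
  have := congrArg (coeff m) h
  simp only [coeff_theta] at this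
  have h' : ((m : ZMod 7) ^ 3 - 1) * coeff m H = 0 := by linear_combination this
  exact (mul_eq_zero.mp h').resolve_left (sub_ne_zero.mpr hm)

theorem expand_seven (g : (ZMod 7)⟦X⟧) : expand 7 (by decide) g = g ^ 7 := by
  have h := MvPowerSeries.map_frobenius_expand (p := 7) (by decide) (f := g)
  rw [ZMod.frobenius_zmod, MvPowerSeries.map_id] at h
  exact h

theorem coeff_pow_forty_nine (g : (ZMod 7)⟦X⟧) (n : ℕ) :
    coeff n (g ^ 49) = if 49 ∣ n then coeff (n / 49) g else 0 := by
  rw [show g ^ 49 = (g ^ 7) ^ 7 by ring, ← expand_seven, ← expand_seven, ← expand_mul, coeff_expand]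

theorem pentagonal_seven_mul_sub_one (j : ℤ) : pentagonal (7 * j - 1) = 49 * pentagonal j + 2 := by
  have h₁ := two_mul_natCast_pentagonal (7 * j - 1)
  have h₂ := two_mul_natCast_pentagonal j
  have : (2 * pentagonal (7 * j - 1) : ℤ) = 2 * (49 * pentagonal j + 2) := by
    rw [h₁]; linear_combination -49 * h₂
  omega

theorem coeff_pentagonalSeries_mul_forty_nine_add_two (m : ℕ) :
    coeff (49 * m + 2) (pentagonalSeries (ZMod 7)) = -coeff m (pentagonalSeries (ZMod 7)) := by
  by_cases hm : m ∈ Set.range pentagonal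
  · obtain ⟨j, rfl⟩ := hm
    rw [← pentagonal_seven_mul_sub_one, coeff_pentagonalSeries_pentagonal,
      coeff_pentagonalSeries_pentagonal, show 7 * j - 1 = j + (6 * j - 1) by ring,
      Int.negOnePow_add, Int.negOnePow_odd (6 * j - 1) ⟨3 * j - 1, by ring⟩]
    simp
  · rw [coeff_pentagonalSeries_eq_zero _ hm, neg_zero]
    refine coeff_pentagonalSeries_eq_zero _ ?_
    rintro ⟨k, hk⟩
    have h₁ := two_mul_natCast_pentagonal k
    rw [hk] at h₁
    obtain ⟨j, rfl⟩ : ∃ j, k = 7 * j - 1 := by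
      have h7 : (7 : ℤ) ∣ (6 * k - 1) ^ 2 := ⟨7 * (24 * m + 1), by push_cast at h₁; linarith⟩
      have : (7 : ℤ) ∣ 6 * k - 1 := Int.Prime.dvd_pow' (p := 7) (by norm_num) h7
      exact ⟨(k + 1) / 7, by omega⟩
    rw [pentagonal_seven_mul_sub_one] at hk
    exact hm ⟨j, by omega⟩

theorem coeff_pentagonalSeries_eq_zero_or (n : ℕ) :
    coeff n (pentagonalSeries (ZMod 7)) = 0 ∨ n % 49 = 2 ∨
      n % 49 ≠ 2 ∧ ((n + 5 : ℕ) : ZMod 7) ^ 3 = -1 := by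
  by_cases hn : n ∈ Set.range pentagonal
  · right
    obtain ⟨k, rfl⟩ := hn
    by_cases hk : (7 : ℤ) ∣ 6 * k - 1
    · left
      obtain ⟨j, rfl⟩ : ∃ j, k = 7 * j - 1 := ⟨(k + 1) / 7, by omega⟩
      rw [pentagonal_seven_mul_sub_one]
      omega
    · right
      have h₁ := two_mul_natCast_pentagonal k
      have hsq : ((6 * k - 1) ^ 2 : ℤ) = 24 * pentagonal k + 1 := by linarith
      constructor
      · intro h
        refine hk (Int.Prime.dvd_pow' (p := 7) (k := 2) (by norm_num) ?_)
        rw [hsq]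
        omega
      · have h6 : (((6 * k - 1 : ℤ) : ZMod 7)) ^ 6 = 1 := by
          refine ZMod.pow_card_sub_one_eq_one fun h ↦ hk ?_
          exact (ZMod.intCast_zmod_eq_zero_iff_dvd _ 7).mp h
        have h := congrArg (Int.cast : ℤ → ZMod 7) hsq
        push_cast at h h6 ⊢
        generalize (pentagonal k : ZMod 7) = x at *
        generalize (6 * (k : ZMod 7) - 1) = y at *
        revert x y
        decide
  · exact Or.inl (coeff_pentagonalSeries_eq_zero _ hn)

theorem theta_theta_theta_pentagonalSeries :
    theta (theta (theta (X ^ 5 * pentagonalSeries (ZMod 7)))) =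
      -(X ^ 5 * pentagonalSeries (ZMod 7)) - X ^ 7 * pentagonalSeries (ZMod 7) ^ 49 := by
  ext N
  simp only [coeff_theta, map_sub, map_neg, coeff_X_pow_mul', coeff_pow_forty_nine]
  obtain hN | ⟨n, rfl⟩ : N < 5 ∨ ∃ n, N = n + 5 :=
    (lt_or_ge N 5).imp_right fun h ↦ ⟨N - 5, by omega⟩
  · simp [show ¬ 5 ≤ N by omega, show ¬ 7 ≤ N by omega]
  rw [if_pos (by omega), Nat.add_sub_cancel]
  by_cases hm : n % 49 = 2
  · obtain ⟨m, rfl⟩ : ∃ m, n = 49 * m + 2 := ⟨n / 49, by omega⟩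
    rw [if_pos (by omega), if_pos (by omega), show (49 * m + 2 + 5 - 7) / 49 = m by omega,
      coeff_pentagonalSeries_mul_forty_nine_add_two]
    have : ((49 * m + 2 + 5 : ℕ) : ZMod 7) = 0 :=
      (ZMod.natCast_eq_zero_iff _ 7).mpr ⟨7 * m + 1, by ring⟩
    rw [this]
    ring
  · have h0 : (if 7 ≤ n + 5 then if 49 ∣ n + 5 - 7 then
        coeff ((n + 5 - 7) / 49) (pentagonalSeries (ZMod 7)) else 0 else 0) = 0 := by
      split_ifs <;> first | rfl | omega
    rw [h0]
    rcases coeff_pentagonalSeries_eq_zero_or n with h | h | ⟨-, h⟩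
    · simp [h]
    · exact absurd h hm
    · linear_combination coeff n (pentagonalSeries (ZMod 7)) * h

section GaussianBinomial
variable {R : Type*} [CommRing R]

/-- The Gaussian binomial coefficients with base `q`. -/
def gaussianBinomial (q : R) : ℕ → ℕ → R
  | _, 0 => 1
  | 0, _ + 1 => 0
  | n + 1, k + 1 => gaussianBinomial q n k + q ^ (k + 1) * gaussianBinomial q n (k + 1)

/-- The finite `q`-Pochhammer symbol `(q; q)_n`. -/
def pochhammer (q : R) (n : ℕ) : R := ∏ i ∈ Finset.range n, (1 - q ^ (i + 1))

theorem pochhammer_succ (q : R) (n : ℕ) :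
    pochhammer q (n + 1) = pochhammer q n * (1 - q ^ (n + 1)) := Finset.prod_range_succ _ _

@[simp]
theorem gaussianBinomial_zero (q : R) (n : ℕ) : gaussianBinomial q n 0 = 1 := by
  cases n <;> rfl

theorem gaussianBinomial_eq_zero (q : R) {n k : ℕ} (h : n < k) : gaussianBinomial q n k = 0 := by
  induction n generalizing k with
  | zero => obtain ⟨k, rfl⟩ := Nat.exists_eq_succ_of_ne_zero h.ne'; rfl
  | succ n ih =>
    obtain ⟨k, rfl⟩ := Nat.exists_eq_succ_of_ne_zero (Nat.ne_zero_of_lt h)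
    rw [Nat.succ_eq_add_one, gaussianBinomial, ih (by omega), ih (by omega), mul_zero, add_zero]

theorem gaussianBinomial_mul_pochhammer (q : R) (m n : ℕ) :
    gaussianBinomial q (m + n) m * (pochhammer q m * pochhammer q n) = pochhammer q (m + n) := by
  induction h : m + n generalizing m n with
  | zero =>
    obtain ⟨rfl, rfl⟩ : m = 0 ∧ n = 0 := by omega
    simp [pochhammer]
  | succ N ih =>
    match m, n with
    | 0, n => obtain rfl : n = N + 1 := by omega
              simp [pochhammer]
    | m + 1, 0 =>
      obtain rfl : m = N := by omega
      have := ih m 0 rfl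
      rw [gaussianBinomial, gaussianBinomial_eq_zero q m.lt_succ_self, mul_zero, add_zero,
        pochhammer_succ]
      linear_combination (1 - q ^ (m + 1)) * this
    | m + 1, n + 1 =>
      have h₁ := ih m (n + 1) (by omega)
      have h₂ := ih (m + 1) n (by omega)
      obtain rfl : N = m + n + 1 := by omega
      rw [pochhammer_succ] at h₁ h₂
      rw [gaussianBinomial, pochhammer_succ q m, pochhammer_succ q n, pochhammer_succ q (m + n + 1)]
      linear_combination (1 - q ^ (m + 1)) * h₁ + q ^ (m + 1) * (1 - q ^ (n + 1)) * h₂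

/-- The homogeneous form of the `q`-binomial theorem. -/
theorem prod_sub_mul_pow_eq_sum (q y z : R) (n : ℕ) :
    ∏ i ∈ Finset.range n, (y - z * q ^ i) = ∑ j ∈ Finset.range (n + 1),
      (-1) ^ j * q ^ (j.choose 2) * gaussianBinomial q n j * z ^ j * y ^ (n - j) := by
  induction n generalizing z with
  | zero => simp
  | succ n ih =>
    have h : ∏ i ∈ Finset.range n, (y - z * q ^ (i + 1)) =
        ∏ i ∈ Finset.range n, (y - z * q * q ^ i) :=
      Finset.prod_congr rfl fun i _ ↦ by ring
    rw [Finset.prod_range_succ', h, ih, pow_zero, mul_one, mul_sub, Finset.sum_mul, Finset.sum_mul,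
      Finset.sum_range_succ', Finset.sum_range_succ' _ (n + 1)]
    have h₀ : ∑ j ∈ Finset.range n, (-1) ^ (j + 1) * q ^ ((j + 1).choose 2) *
          gaussianBinomial q n (j + 1) * (z * q) ^ (j + 1) * y ^ (n - (j + 1)) * y =
        ∑ j ∈ Finset.range (n + 1), (-1) ^ (j + 1) * q ^ ((j + 1).choose 2) *
          gaussianBinomial q n (j + 1) * (z * q) ^ (j + 1) * y ^ (n - j) := by
      rw [Finset.sum_range_succ, gaussianBinomial_eq_zero q n.lt_succ_self]
      simp only [mul_zero, zero_mul, add_zero]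
      refine Finset.sum_congr rfl fun j hj ↦ ?_
      rw [mul_assoc, ← pow_succ, show n - (j + 1) + 1 = n - j by grind]
    have h₁ (a b c : R) : a + b - c = (a - c) + b := by ring
    rw [h₀, h₁, ← Finset.sum_sub_distrib]
    congr 1
    · refine Finset.sum_congr rfl fun j _ ↦ ?_
      rw [Nat.add_sub_add_right, gaussianBinomial, Nat.choose_succ_succ' j 1, Nat.choose_one_right]
      ring
    · simp [pow_succ]

end GaussianBinomial

section Limit
variable {R : Type*} [CommRing R]

theorem map_gaussianBinomial {S : Type*} [CommRing S] (φ : R →+* S) (q : R) (n k : ℕ) :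
    φ (gaussianBinomial q n k) = gaussianBinomial (φ q) n k := by
  induction n generalizing k with
  | zero => cases k <;> simp [gaussianBinomial]
  | succ n ih => cases k <;> simp [gaussianBinomial, ih]

theorem map_pochhammer {S : Type*} [CommRing S] (φ : R →+* S) (q : R) (n : ℕ) :
    φ (pochhammer q n) = pochhammer (φ q) n := by
  simp [pochhammer]

theorem X_pow_dvd_pentagonalSeries_sub (n : ℕ) :
    (X : R⟦X⟧) ^ (n + 1) ∣ pentagonalSeries R - pochhammer X n := by
  rw [X_pow_dvd_iff]
  intro m hm
  obtain ⟨s, hs⟩ := Filter.eventually_atTop.mp (coeff_prod_one_sub_X_pow_eventually_eq R m)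
  have h := hs (s ∪ Finset.range n) Finset.subset_union_left
  have htail : (X : R⟦X⟧) ^ (n + 1) ∣ ∏ i ∈ s \ Finset.range n, (1 - X ^ (i + 1)) - 1 := by
    refine Finset.prod_induction _ (fun p : R⟦X⟧ ↦ X ^ (n + 1) ∣ p - 1) ?_ (by simp) ?_
    · rintro a b ⟨u, hu⟩ ⟨v, hv⟩
      exact ⟨u * b + v, by linear_combination b * hu + hv⟩
    · intro i hi
      have : n ≤ i := by simpa using (Finset.mem_sdiff.mp hi).2
      rw [sub_sub_cancel_left, dvd_neg]
      exact pow_dvd_pow _ (by omega)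
  rw [← Finset.sdiff_union_self_eq_union, Finset.prod_union Finset.sdiff_disjoint] at h
  rw [map_sub, ← h, ← map_sub]
  refine X_pow_dvd_iff.mp ?_ m hm
  have := htail.mul_right (pochhammer X n)
  rwa [sub_mul, one_mul] at this

theorem isUnit_pentagonalSeries : IsUnit (pentagonalSeries R) := by
  rw [isUnit_iff_constantCoeff]
  have := X_pow_dvd_iff.mp (X_pow_dvd_pentagonalSeries_sub (R := R) 0) 0 (by omega)
  simp [pochhammer, sub_eq_zero] at this
  simp [this]

theorem X_pow_dvd_pentagonalSeries_mul_gaussianBinomial_sub_one {r m n : ℕ} (hm : r ≤ m)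
    (hn : r ≤ n) :
    (X : R⟦X⟧) ^ (r + 1) ∣ pentagonalSeries R * gaussianBinomial X (m + n) m - 1 := by
  have h {k : ℕ} (hk : r ≤ k) : (X : R⟦X⟧) ^ (r + 1) ∣ pentagonalSeries R - pochhammer X k :=
    (pow_dvd_pow _ (by omega)).trans (X_pow_dvd_pentagonalSeries_sub k)
  obtain ⟨a, ha⟩ := h hm
  obtain ⟨b, hb⟩ := h hn
  obtain ⟨c, hc⟩ := h (hm.trans (Nat.le_add_right m n))
  have hg := gaussianBinomial_mul_pochhammer (X : R⟦X⟧) m n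
  rw [← (isUnit_pentagonalSeries (R := R)).dvd_mul_left]
  generalize pentagonalSeries R = E at *
  generalize gaussianBinomial (X : R⟦X⟧) (m + n) m = g at *
  exact ⟨g * (a * E + pochhammer X m * b) - c,
    by linear_combination g * (E * ha + pochhammer X m * hb) - hc + hg⟩

end Limit

section FiniteJacobi
variable {R : Type*} [CommRing R]

/-- The number `k (k - 1) / 2` for an integer `k`. -/
def triangular (k : ℤ) : ℕ := (k * (k - 1) / 2).toNat

theorem two_mul_natCast_triangular (k : ℤ) : 2 * (triangular k : ℤ) = k * (k - 1) := by
  have h : 0 ≤ k * (k - 1) := by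
    rcases le_or_gt k 0 with hk | hk <;> nlinarith
  rw [triangular, Int.toNat_of_nonneg (by omega)]
  exact Int.two_mul_ediv_two_of_even (Int.even_mul_pred_self k)

theorem two_mul_natCast_choose_two (n : ℕ) : 2 * (n.choose 2 : ℤ) = n * (n - 1) := by
  have := Nat.cast_choose_two ℚ n
  have h : 2 * (n.choose 2 : ℚ) = n * (n - 1) := by rw [this]; ring
  exact_mod_cast h

theorem prod_range_const_mul (c : R) (f : ℕ → R) (n : ℕ) :
    ∏ i ∈ Finset.range n, c * f i = c ^ n * ∏ i ∈ Finset.range n, f i := by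
  rw [Finset.prod_mul_distrib, Finset.prod_const, Finset.card_range]

theorem prod_pow_sub_pow (q : R) (n : ℕ) :
    ∏ i ∈ Finset.range n, (q ^ n - q ^ i) = (-1) ^ n * q ^ (n.choose 2) * pochhammer q n := by
  induction n with
  | zero => simp [pochhammer]
  | succ n ih =>
    have h : ∏ i ∈ Finset.range n, (q ^ (n + 1) - q ^ (i + 1)) =
        q ^ n * ∏ i ∈ Finset.range n, (q ^ n - q ^ i) := by
      rw [← prod_range_const_mul]
      exact Finset.prod_congr rfl fun i _ ↦ by ring
    rw [Finset.prod_range_succ', h, ih, pochhammer_succ, Nat.choose_succ_succ' n 1,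
      Nat.choose_one_right]
    ring

theorem choose_two_add_mul_eq {n j : ℕ} (hj : j ≤ 2 * n + 1) :
    j.choose 2 + n * (2 * n + 1 - j) = triangular (j - n) + (n + n.choose 2 + n * n) := by
  have h₁ := two_mul_natCast_triangular (j - n)
  have h₂ := two_mul_natCast_choose_two j
  have h₃ := two_mul_natCast_choose_two n
  zify [hj]
  linarith

theorem two_mul_pochhammer_sq [IsDomain R] {q : R} (hq : q ≠ 0) (n : ℕ) :
    2 * pochhammer q n ^ 2 = ∑ j ∈ Finset.range (2 * n + 2), (-1) ^ (j + n + 1) *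
      (2 * (j : R) - 2 * n - 1) * q ^ triangular (j - n) * gaussianBinomial q (2 * n + 1) j := by
  have key := prod_sub_mul_pow_eq_sum (Polynomial.C q) (Polynomial.C (q ^ n)) Polynomial.X
    (2 * n + 1)
  rw [show 2 * n + 1 = n + 1 + n by ring, Finset.prod_range_add, Finset.prod_range_succ,
    show n + 1 + n = 2 * n + 1 by ring] at key
  set c := n + n.choose 2 + n * n with hc
  have hpow (j : ℕ) (hj : j ∈ Finset.range (2 * n + 2)) :
      q ^ (j.choose 2) * (q ^ n) ^ (2 * n + 1 - j) = q ^ c * q ^ triangular (j - n) := by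
    rw [← pow_mul, ← pow_add, choose_two_add_mul_eq (by grind), pow_add, mul_comm]
  have hsnd : ∏ i ∈ Finset.range n, (q ^ n - q ^ (n + 1 + i)) = q ^ (n * n) * pochhammer q n := by
    rw [pow_mul, pochhammer, ← prod_range_const_mul]
    exact Finset.prod_congr rfl fun i _ ↦ by ring
  have hsum : ∑ j ∈ Finset.range (2 * n + 2), (-1) ^ j * Polynomial.C q ^ (j.choose 2) *
        gaussianBinomial (Polynomial.C q) (2 * n + 1) j * Polynomial.X ^ j *
        Polynomial.C (q ^ n) ^ (2 * n + 1 - j) =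
      ∑ j ∈ Finset.range (2 * n + 2), Polynomial.C (q ^ c * ((-1) ^ j * q ^ triangular (j - n) *
        gaussianBinomial q (2 * n + 1) j)) * Polynomial.X ^ j := by
    refine Finset.sum_congr rfl fun j hj ↦ ?_
    rw [mul_assoc ((-1) ^ j) (q ^ _), mul_left_comm (q ^ c), ← mul_assoc (q ^ c), ← hpow j hj,
      ← map_gaussianBinomial]
    simp only [map_mul, map_pow, map_neg, map_one]
    ring
  rw [hsum] at key
  have h₀ : ∑ j ∈ Finset.range (2 * n + 2), (-1) ^ j * q ^ triangular (j - n) *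
      gaussianBinomial q (2 * n + 1) j = 0 := by
    refine mul_left_cancel₀ (pow_ne_zero c hq) ?_
    have := congrArg (Polynomial.eval 1) key
    rw [mul_zero, Finset.mul_sum]
    simpa [Polynomial.eval_finsetSum, -map_mul, -map_pow] using this.symm
  have h₁ : ∑ j ∈ Finset.range (2 * n + 2), (-1) ^ j * (j : R) * q ^ triangular (j - n) *
      gaussianBinomial q (2 * n + 1) j = -(-1) ^ n * pochhammer q n ^ 2 := by
    refine mul_left_cancel₀ (pow_ne_zero c hq) ?_
    have hfst : Polynomial.eval 1 (∏ i ∈ Finset.range n, (Polynomial.C (q ^ n) -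
        Polynomial.X * Polynomial.C q ^ i)) = (-1) ^ n * q ^ (n.choose 2) * pochhammer q n := by
      rw [← prod_pow_sub_pow, Polynomial.eval_prod]
      simp
    have hsnd' : Polynomial.eval 1 (∏ i ∈ Finset.range n, (Polynomial.C (q ^ n) -
        Polynomial.X * Polynomial.C q ^ (n + 1 + i))) = q ^ (n * n) * pochhammer q n := by
      rw [← hsnd, Polynomial.eval_prod]
      simp
    have := congrArg (fun p ↦ Polynomial.eval 1 (Polynomial.derivative p)) key
    simp only [Polynomial.derivative_sum, Polynomial.eval_finsetSum, Polynomial.derivative_mul,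
      Polynomial.derivative_X_pow] at this
    simp only [Polynomial.eval_add, Polynomial.eval_mul, hfst, hsnd', Polynomial.eval_pow,
      Polynomial.eval_C, Polynomial.eval_X, one_pow, mul_one] at this
    simp only [← map_pow, Polynomial.derivative_sub, Polynomial.derivative_mul,
      Polynomial.derivative_C, Polynomial.derivative_X, Polynomial.eval_sub, Polynomial.eval_mul,
      Polynomial.eval_C, Polynomial.eval_X, one_mul, sub_self, mul_zero, zero_mul, zero_sub,
      add_zero, zero_add, Polynomial.eval_neg, Polynomial.eval_zero] at this
    rw [Finset.mul_sum]
    refine (Finset.sum_congr rfl fun j _ ↦ by ring).trans (this.symm.trans ?_)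
    rw [hc]
    ring
  have hn : ((-1 : R) ^ n) ^ 2 = 1 := by rw [← pow_mul, mul_comm, pow_mul]; simp
  have : 2 * pochhammer q n ^ 2 = -(-1) ^ n * (2 * (∑ j ∈ Finset.range (2 * n + 2),
      (-1) ^ j * (j : R) * q ^ triangular (j - n) * gaussianBinomial q (2 * n + 1) j) -
      (2 * n + 1) * ∑ j ∈ Finset.range (2 * n + 2), (-1) ^ j * q ^ triangular (j - n) *
        gaussianBinomial q (2 * n + 1) j) := by
    rw [h₀, h₁]
    linear_combination -2 * pochhammer q n ^ 2 * hn
  rw [this, Finset.mul_sum, Finset.mul_sum, ← Finset.sum_sub_distrib, Finset.mul_sum]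
  exact Finset.sum_congr rfl fun j _ ↦ by ring

end FiniteJacobi

section Jacobi
variable {R : Type*} [CommRing R] [IsDomain R]

theorem X_pow_dvd_two_mul_pentagonalSeries_pow_three_sub (n : ℕ) :
    (X : R⟦X⟧) ^ (n + 1) ∣ 2 * pentagonalSeries R ^ 3 - ∑ j ∈ Finset.range (2 * n + 2),
      C ((-1) ^ (j + n + 1) * (2 * (j : R) - 2 * n - 1)) * X ^ triangular (j - n) := by
  have hP := two_mul_pochhammer_sq (X_ne_zero (R := R)) n
  obtain ⟨u, hu⟩ := X_pow_dvd_pentagonalSeries_sub (R := R) n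
  have h (j : ℕ) (hj : j ∈ Finset.range (2 * n + 2)) : (X : R⟦X⟧) ^ (n + 1) ∣
      C ((-1) ^ (j + n + 1) * (2 * (j : R) - 2 * n - 1)) * X ^ triangular (j - n) *
        (pentagonalSeries R * gaussianBinomial X (2 * n + 1) j - 1) := by
    have hj : j ≤ 2 * n + 1 := by grind
    have ht := two_mul_natCast_triangular (j - n)
    have hr := X_pow_dvd_pentagonalSeries_mul_gaussianBinomial_sub_one (R := R)
      (min_le_left j (2 * n + 1 - j)) (min_le_right j (2 * n + 1 - j))
    rw [Nat.add_sub_cancel' hj] at hr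
    refine (pow_dvd_pow X ?_).trans ((pow_add X (triangular (j - n))
      (min j (2 * n + 1 - j) + 1)).dvd.trans (mul_dvd_mul (Dvd.intro_left _ rfl) hr))
    rcases le_or_gt j n with hjn | hjn
    · obtain ⟨k, rfl⟩ := Nat.exists_eq_add_of_le hjn
      rw [min_eq_left (by omega)]
      push_cast at ht
      have : k ≤ triangular (j - ↑(j + k)) := by push_cast; nlinarith
      omega
    · obtain ⟨k, rfl⟩ := Nat.exists_eq_add_of_le (Nat.succ_le_of_lt hjn)
      rw [min_eq_right (by omega)]
      push_cast at ht
      have : k ≤ triangular (↑(n.succ + k) - n) := by push_cast; nlinarith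
      omega
  obtain ⟨v, hv⟩ := Finset.dvd_sum h
  simp only [mul_sub_one (C _ * _), Finset.sum_sub_distrib] at hv
  have hE : pentagonalSeries R * (2 * pochhammer X n ^ 2) = ∑ j ∈ Finset.range (2 * n + 2),
      C ((-1) ^ (j + n + 1) * (2 * (j : R) - 2 * n - 1)) * X ^ triangular (j - n) *
        (pentagonalSeries R * gaussianBinomial X (2 * n + 1) j) := by
    rw [hP, Finset.mul_sum]
    refine Finset.sum_congr rfl fun j _ ↦ ?_
    simp only [map_mul, map_pow, map_neg, map_one, map_sub, map_ofNat, map_natCast]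
    ring
  rw [← hE] at hv
  exact ⟨2 * pentagonalSeries R * (pentagonalSeries R + pochhammer X n) * u + v,
    by linear_combination 2 * pentagonalSeries R * (pentagonalSeries R + pochhammer X n) * hu + hv⟩

end Jacobi

theorem theta_C_mul_X_pow {R : Type*} [CommRing R] (c : R) (n : ℕ) :
    theta (C c * X ^ n : R⟦X⟧) = C (c * n) * X ^ n := by
  ext m
  simp only [coeff_theta, coeff_C_mul, coeff_X_pow]
  split_ifs with h
  · rw [h]; ring
  · ring

theorem two_mul_sub_one_mul_triangular_add_one_pow_three (k : ℤ) :
    (2 * (k : ZMod 7) - 1) * ((triangular k + 1 : ℕ) : ZMod 7) ^ 3 = 2 * (k : ZMod 7) - 1 := by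
  have h := congrArg (Int.cast : ℤ → ZMod 7) (two_mul_natCast_triangular k)
  push_cast at h ⊢
  generalize (k : ZMod 7) = k at *
  generalize (triangular _ : ZMod 7) = t at *
  revert k t
  decide

theorem theta_theta_theta_pentagonalSeries_pow_three :
    theta (theta (theta (X * pentagonalSeries (ZMod 7) ^ 3))) =
      X * pentagonalSeries (ZMod 7) ^ 3 := by
  have h2 : theta (2 : (ZMod 7)⟦X⟧) = 0 := theta_natCast 2
  rw [← sub_eq_zero]
  refine eq_zero_of_forall_X_pow_dvd fun n ↦ ?_
  obtain ⟨v, hv⟩ := X_pow_dvd_two_mul_pentagonalSeries_pow_three_sub (R := ZMod 7) n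
  set S := ∑ j ∈ Finset.range (2 * n + 2),
    C ((-1) ^ (j + n + 1) * (2 * (j : ZMod 7) - 2 * n - 1)) * X ^ triangular (j - n) with hS
  have hθ : theta (theta (theta (X * S))) = X * S := by
    simp only [hS, Finset.mul_sum, map_sum, mul_left_comm X (C _), ← pow_succ', theta_C_mul_X_pow]
    refine Finset.sum_congr rfl fun j _ ↦ ?_
    have h := two_mul_sub_one_mul_triangular_add_one_pow_three (j - n)
    push_cast at h ⊢
    congr 2
    linear_combination (-1) ^ (j + n + 1) * h
  obtain ⟨w, hw⟩ : X ^ n ∣ theta (theta (theta (X ^ n * (X ^ 2 * v)))) :=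
    X_pow_dvd_theta (X_pow_dvd_theta (X_pow_dvd_theta (Dvd.intro _ rfl)))
  have h := congrArg (fun f ↦ theta (theta (theta f)))
    (show 2 * (X * pentagonalSeries (ZMod 7) ^ 3) = X * S + X ^ n * (X ^ 2 * v) by
      linear_combination X * hv)
  simp only [theta_mul 2, map_add, h2, zero_mul, add_zero, hθ, hw] at h
  refine ⟨4 * w - 4 * X ^ 2 * v, ?_⟩
  linear_combination 4 * h - 4 * X * hv - (theta (theta (theta (X * pentagonalSeries (ZMod 7) ^ 3)))
    - X * pentagonalSeries (ZMod 7) ^ 3) * seven_eq_zero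

section FiniteGauss
variable {R : Type*} [CommRing R]

/-- The finite product `(q; q²)_n`. -/
def oddPochhammer (q : R) (n : ℕ) : R := ∏ i ∈ Finset.range n, (1 - q ^ (2 * i + 1))

theorem oddPochhammer_succ (q : R) (n : ℕ) :
    oddPochhammer q (n + 1) = oddPochhammer q n * (1 - q ^ (2 * n + 1)) :=
  Finset.prod_range_succ _ _

theorem pochhammer_two_mul (q : R) (n : ℕ) :
    pochhammer q (2 * n) = oddPochhammer q n * pochhammer (q ^ 2) n := by
  induction n with
  | zero => simp [pochhammer, oddPochhammer]
  | succ n ih =>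
    rw [mul_add_one, pochhammer_succ, pochhammer_succ, ih, oddPochhammer_succ, pochhammer_succ]
    ring

theorem prod_pow_sub_pow_odd (q : R) (n : ℕ) :
    ∏ i ∈ Finset.range n, (q ^ (2 * n) - q * (q ^ 2) ^ i) =
      (-1) ^ n * q ^ (n * n) * oddPochhammer q n := by
  induction n with
  | zero => simp [oddPochhammer]
  | succ n ih =>
    have h : ∏ i ∈ Finset.range n, (q ^ (2 * (n + 1)) - q * (q ^ 2) ^ (i + 1)) =
        (q ^ 2) ^ n * ∏ i ∈ Finset.range n, (q ^ (2 * n) - q * (q ^ 2) ^ i) := by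
      rw [← prod_range_const_mul]
      exact Finset.prod_congr rfl fun i _ ↦ by ring
    rw [Finset.prod_range_succ', h, ih, oddPochhammer_succ]
    ring

theorem oddPochhammer_sq [IsDomain R] {q : R} (hq : q ≠ 0) (n : ℕ) :
    oddPochhammer q n ^ 2 = ∑ j ∈ Finset.range (2 * n + 1),
      (-1) ^ (j + n) * q ^ ((j - n : ℤ).natAbs ^ 2) * gaussianBinomial (q ^ 2) (2 * n) j := by
  have key := prod_sub_mul_pow_eq_sum (q ^ 2) (q ^ (2 * n)) q (n + n)
  have hsnd : ∏ i ∈ Finset.range n, (q ^ (2 * n) - q * (q ^ 2) ^ (n + i)) =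
      q ^ (2 * n * n) * oddPochhammer q n := by
    rw [pow_mul q (2 * n) n, oddPochhammer, ← prod_range_const_mul]
    exact Finset.prod_congr rfl fun i _ ↦ by ring
  rw [Finset.prod_range_add, prod_pow_sub_pow_odd, hsnd, ← two_mul] at key
  have hn : ((-1 : R) ^ n) ^ 2 = 1 := by rw [← pow_mul, mul_comm, pow_mul]; simp
  refine mul_left_cancel₀ (pow_ne_zero (3 * n * n) hq) ?_
  trans (-1) ^ n * ((-1) ^ n * q ^ (n * n) * oddPochhammer q n *
    (q ^ (2 * n * n) * oddPochhammer q n))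
  · linear_combination -q ^ (3 * n * n) * oddPochhammer q n ^ 2 * hn
  rw [key, Finset.mul_sum, Finset.mul_sum]
  refine Finset.sum_congr rfl fun j hj ↦ ?_
  have hj : j ≤ 2 * n := by grind
  have he : 2 * j.choose 2 + j + 2 * n * (2 * n - j) = 3 * n * n + (j - n : ℤ).natAbs ^ 2 := by
    have := two_mul_natCast_choose_two j
    zify [hj]
    rw [sq_abs]
    linarith
  have hq' : (q ^ 2) ^ j.choose 2 * q ^ j * (q ^ (2 * n)) ^ (2 * n - j) =
      q ^ (3 * n * n) * q ^ ((j - n : ℤ).natAbs ^ 2) := by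
    rw [← pow_mul, ← pow_mul, ← pow_add, ← pow_add, he, pow_add]
  linear_combination (-1) ^ (j + n) * gaussianBinomial (q ^ 2) (2 * n) j * hq'

end FiniteGauss

section Gauss
variable {R : Type*} [CommRing R] [IsDomain R]

theorem X_pow_dvd_sub_sum_of_mul_eq {φ : R⟦X⟧}
    (hφ : φ * expand 2 two_ne_zero (pentagonalSeries R) = pentagonalSeries R ^ 2) (n : ℕ) :
    (X : R⟦X⟧) ^ (n + 1) ∣ φ - ∑ j ∈ Finset.range (2 * n + 1),
      C ((-1) ^ (j + n)) * X ^ ((j - n : ℤ).natAbs ^ 2) := by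
  have hO := oddPochhammer_sq (X_ne_zero (R := R)) n
  obtain ⟨u, hu⟩ := (pow_dvd_pow (X : R⟦X⟧) (show n + 1 ≤ 2 * n + 1 by omega)).trans
    (X_pow_dvd_pentagonalSeries_sub (R := R) (2 * n))
  have hexp {m : ℕ} {f : R⟦X⟧} (h : X ^ m ∣ f) : X ^ (2 * m) ∣ expand 2 two_ne_zero f := by
    have := map_dvd (expand (R := R) 2 two_ne_zero) h
    rwa [map_pow, expand_X, ← pow_mul] at this
  have hP (k : ℕ) : expand 2 two_ne_zero (pochhammer (X : R⟦X⟧) k) = pochhammer (X ^ 2) k := by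
    rw [← expand_X (R := R) 2 two_ne_zero]
    exact map_pochhammer (expand 2 two_ne_zero : R⟦X⟧ →ₐ[R] R⟦X⟧).toRingHom X k
  have hG (m k : ℕ) : expand 2 two_ne_zero (gaussianBinomial (X : R⟦X⟧) m k) =
      gaussianBinomial (X ^ 2) m k := by
    rw [← expand_X (R := R) 2 two_ne_zero]
    exact map_gaussianBinomial (expand 2 two_ne_zero : R⟦X⟧ →ₐ[R] R⟦X⟧).toRingHom X m k
  obtain ⟨v, hv⟩ := (pow_dvd_pow (X : R⟦X⟧) (show n + 1 ≤ 2 * (n + 1) by omega)).trans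
    (hexp (X_pow_dvd_pentagonalSeries_sub (R := R) n))
  have hunit : IsUnit (expand 2 two_ne_zero (pentagonalSeries R)) :=
    isUnit_pentagonalSeries.map (expand 2 two_ne_zero : R⟦X⟧ →ₐ[R] R⟦X⟧)
  have h (j : ℕ) (hj : j ∈ Finset.range (2 * n + 1)) : (X : R⟦X⟧) ^ (n + 1) ∣
      C ((-1) ^ (j + n)) * X ^ ((j - n : ℤ).natAbs ^ 2) *
        (expand 2 two_ne_zero (pentagonalSeries R) * gaussianBinomial (X ^ 2) (2 * n) j - 1) := by
    have hj : j ≤ 2 * n := by grind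
    have hr := hexp (X_pow_dvd_pentagonalSeries_mul_gaussianBinomial_sub_one (R := R)
      (min_le_left j (2 * n - j)) (min_le_right j (2 * n - j)))
    rw [Nat.add_sub_cancel' hj, map_sub, map_mul, map_one, hG] at hr
    refine (pow_dvd_pow X ?_).trans ((pow_add X ((j - n : ℤ).natAbs ^ 2)
      (2 * (min j (2 * n - j) + 1))).dvd.trans (mul_dvd_mul (Dvd.intro_left _ rfl) hr))
    have hm : min j (2 * n - j) + (j - n : ℤ).natAbs = n := by omega
    nlinarith [sq_nonneg (((j - n : ℤ).natAbs : ℤ) - 1)]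
  obtain ⟨w, hw⟩ := Finset.dvd_sum h
  simp only [mul_sub_one (C _ * _), Finset.sum_sub_distrib] at hw
  rw [map_sub, hP] at hv
  have hprod := pochhammer_two_mul (X : R⟦X⟧) n
  have hE : expand 2 two_ne_zero (pentagonalSeries R) * oddPochhammer X n ^ 2 =
      ∑ j ∈ Finset.range (2 * n + 1), C ((-1) ^ (j + n)) * X ^ ((j - n : ℤ).natAbs ^ 2) *
        (expand 2 two_ne_zero (pentagonalSeries R) * gaussianBinomial (X ^ 2) (2 * n) j) := by
    rw [hO, Finset.mul_sum]
    refine Finset.sum_congr rfl fun j _ ↦ ?_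
    simp only [map_pow, map_neg, map_one]
    ring
  rw [← hE] at hw
  generalize expand 2 two_ne_zero (pentagonalSeries R) = f at *
  generalize pentagonalSeries R = e at *
  generalize ∑ j ∈ Finset.range (2 * n + 1), C ((-1 : R) ^ (j + n)) *
    X ^ ((j - n : ℤ).natAbs ^ 2) = S at *
  rw [← hunit.dvd_mul_left]
  generalize pochhammer (X : R⟦X⟧) (2 * n) = p at *
  generalize pochhammer ((X : R⟦X⟧) ^ 2) n = r at *
  subst hprod
  generalize oddPochhammer (X : R⟦X⟧) n = o at *
  exact ⟨(e + o * r) * u - o ^ 2 * (f + r) * v + f * w, by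
    linear_combination hφ + (e + o * r) * hu - o ^ 2 * (f + r) * hv + f * hw⟩

end Gauss

theorem sum_sub_theta_theta_theta (n : ℕ) :
    ∑ j ∈ Finset.range (2 * (7 * n) + 1), (C (R := ZMod 7) ((-1) ^ (j + 7 * n)) *
        X ^ ((j - (7 * n : ℕ) : ℤ).natAbs ^ 2) - theta (theta (theta
          (C ((-1) ^ (j + 7 * n)) * X ^ ((j - (7 * n : ℕ) : ℤ).natAbs ^ 2))))) =
      (∑ i ∈ Finset.range (2 * n + 1),
        C ((-1) ^ (i + n)) * X ^ ((i - n : ℤ).natAbs ^ 2)) ^ 49 := by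
  rw [show 49 = 7 * 7 by norm_num, pow_mul, sum_pow_char, sum_pow_char]
  simp only [theta_C_mul_X_pow]
  refine (Finset.sum_of_injOn (7 * ·) (fun i _ j _ h ↦ by simpa using h)
    (fun i hi ↦ by simp only [Finset.coe_range, Set.mem_Iio] at hi ⊢; omega) ?_ ?_).symm
  · intro j hj hji
    have h7 : ¬ (7 : ℤ) ∣ j - (7 * n : ℕ) := by
      intro h
      simp only [Finset.mem_range, Finset.coe_range, Set.mem_image, Set.mem_Iio, not_exists,
        not_and] at hj hji
      exact hji (j / 7) (by omega) (by omega)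
    generalize (j - (7 * n : ℕ) : ℤ) = k at *
    have h6 : ((k.natAbs : ℕ) : ZMod 7) ^ 6 = 1 := by
      refine ZMod.pow_card_sub_one_eq_one fun h ↦ h7 ?_
      exact Int.natCast_dvd.mpr ((ZMod.natCast_eq_zero_iff _ 7).mp h)
    rw [← sub_mul, ← map_sub]
    push_cast
    generalize ((k.natAbs : ℕ) : ZMod 7) = x at *
    rw [show (-1 : ZMod 7) ^ (j + 7 * n) - (-1) ^ (j + 7 * n) * x ^ 2 * x ^ 2 * x ^ 2 = 0 by
      linear_combination -(-1) ^ (j + 7 * n) * h6, map_zero, zero_mul]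
  · intro i _
    have hk : ((7 * i : ℕ) - (7 * n : ℕ) : ℤ).natAbs = 7 * (i - n : ℤ).natAbs := by omega
    have h0 : (((7 * (i - n : ℤ).natAbs) ^ 2 : ℕ) : ZMod 7) = 0 :=
      (ZMod.natCast_eq_zero_iff _ 7).mpr (Dvd.dvd.pow ⟨_, rfl⟩ two_ne_zero)
    have hs : ((-1 : ZMod 7) ^ (7 * i + 7 * n)) = (-1) ^ (i + n) := by
      rw [← mul_add, pow_mul]
      norm_num
    rw [hk, hs, h0, mul_zero, map_zero, zero_mul, sub_zero]
    rw [← pow_mul, mul_pow, ← map_pow, ← pow_mul X]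
    congr 2
    · rw [← pow_mul, mul_comm, pow_mul]
      norm_num
    · ring

theorem theta_theta_theta_of_mul_eq {φ : (ZMod 7)⟦X⟧}
    (hφ : φ * expand 2 two_ne_zero (pentagonalSeries (ZMod 7)) = pentagonalSeries (ZMod 7) ^ 2) :
    theta (theta (theta φ)) = φ - φ ^ 49 := by
  refine (sub_eq_zero.mp (eq_zero_of_forall_X_pow_dvd fun n ↦ ?_)).symm
  have h₁ := (pow_dvd_pow (X : (ZMod 7)⟦X⟧) (show n ≤ 7 * n + 1 by omega)).trans
    (X_pow_dvd_sub_sum_of_mul_eq hφ (7 * n))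
  have h₂ := ((pow_dvd_pow (X : (ZMod 7)⟦X⟧) n.le_succ).trans
    (X_pow_dvd_sub_sum_of_mul_eq hφ n)).trans (sub_dvd_pow_sub_pow _ _ 49)
  have h₃ := sum_sub_theta_theta_theta n
  simp only [Finset.sum_sub_distrib, ← map_sum] at h₃
  rw [← h₃] at h₂
  have h₄ := X_pow_dvd_theta (X_pow_dvd_theta (X_pow_dvd_theta h₁))
  simp only [map_sub] at h₄
  convert (h₁.sub h₂).sub h₄ using 1
  ring

section GeneratingFunction
variable {R : Type*} [CommRing R]

open PowerSeries.WithPiTopology in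
theorem mk_card_restricted_mul_eq_one [TopologicalSpace R] [T2Space R] [IsTopologicalRing R]
    (p : ℕ → Prop) [DecidablePred p] {G : R⟦X⟧}
    (hG : HasProd (fun i ↦ if p (i + 1) then 1 - X ^ (i + 1) else 1) G) :
    mk (fun n ↦ ((Nat.Partition.restricted n p).card : R)) * G = 1 := by
  refine ((Nat.Partition.hasProd_powerSeriesMk_card_restricted R p).mul hG).unique ?_
  convert hasProd_one using 2 with i
  split_ifs
  · simp_rw [pow_mul]
    exact tsum_pow_mul_one_sub_of_constantCoeff_eq_zero (by simp)
  · exact one_mul 1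

open PowerSeries.WithPiTopology in
theorem continuous_expand [TopologicalSpace R] (d : ℕ) (hd : d ≠ 0) :
    Continuous (expand d hd : R⟦X⟧ → R⟦X⟧) := by
  refine continuous_iff_continuousAt.mpr fun f ↦ (tendsto_iff_coeff_tendsto R _ _ _).mpr fun n ↦ ?_
  simp only [coeff_expand]
  split_ifs
  · exact (continuous_coeff R (n / d)).continuousAt
  · exact tendsto_const_nhds

open PowerSeries.WithPiTopology in
theorem hasProd_even_one_sub_X_pow [TopologicalSpace R] :
    HasProd (fun i ↦ if Even (i + 1) then 1 - X ^ (i + 1) else 1)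
      (expand 2 two_ne_zero (pentagonalSeries R)) := by
  have h := (hasProd_one_sub_X_pow R).map
    (expand 2 two_ne_zero : R⟦X⟧ →ₐ[R] R⟦X⟧) (continuous_expand 2 two_ne_zero)
  have hinj : Function.Injective fun i : ℕ ↦ 2 * i + 1 := fun i j h ↦ by simpa using h
  refine (hinj.hasProd_iff fun i hi ↦ if_neg fun ⟨k, hk⟩ ↦ hi ⟨k - 1, by grind⟩).mp ?_
  convert h using 1
  ext1 i
  have : Even (2 * i + 1 + 1) := ⟨i + 1, by ring⟩
  simp [this, ← pow_mul, mul_add_one, add_assoc]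

theorem mk_cubicPartition_mul :
    mk (fun n ↦ (cubicPartition n : R)) *
      (pentagonalSeries R * expand 2 two_ne_zero (pentagonalSeries R)) = 1 := by
  let : TopologicalSpace R := ⊥
  have : DiscreteTopology R := ⟨rfl⟩
  have h₁ := mk_card_restricted_mul_eq_one (R := R) (fun _ ↦ True)
    (by simpa using WithPiTopology.hasProd_one_sub_X_pow R)
  have h₂ := mk_card_restricted_mul_eq_one (R := R) Even hasProd_even_one_sub_X_pow
  have h : mk (fun n ↦ (cubicPartition n : R)) =
      mk (fun n ↦ ((Nat.Partition.restricted n fun _ ↦ True).card : R)) *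
        mk (fun n ↦ ((Nat.Partition.restricted n Even).card : R)) := by
    ext n
    rw [coeff_mul, Finset.Nat.sum_antidiagonal_eq_sum_range_succ_mk]
    simp [cubicPartition, Nat.Partition.restricted, Fintype.card_subtype]
  rw [h]
  linear_combination h₁ * (mk (fun n ↦ ((Nat.Partition.restricted n Even).card : R)) *
    expand 2 two_ne_zero (pentagonalSeries R)) + h₂

end GeneratingFunction

theorem constantCoeff_pentagonalSeries (R : Type*) [CommRing R] :
    constantCoeff (pentagonalSeries R) = 1 := by
  simpa [pentagonal] using coeff_pentagonalSeries_pentagonal (R := R) 0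

theorem coeff_one_pentagonalSeries (R : Type*) [CommRing R] :
    coeff 1 (pentagonalSeries R) = -1 := by
  simpa [pentagonal] using coeff_pentagonalSeries_pentagonal (R := R) 1

end CubicPartition

end

open PowerSeries CubicPartition in
theorem cubicPartition_mod_seven_29 (n : ℕ) : 7 ∣ cubicPartition (49 * n + 29) := by
  have hunit : IsUnit (expand 2 two_ne_zero (pentagonalSeries (ZMod 7))) :=
    isUnit_pentagonalSeries.map (expand 2 two_ne_zero : (ZMod 7)⟦X⟧ →ₐ[ZMod 7] (ZMod 7)⟦X⟧)
  obtain ⟨φ, hφ⟩ := hunit.dvd (a := pentagonalSeries (ZMod 7) ^ 2)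
  have hφ : φ * expand 2 two_ne_zero (pentagonalSeries (ZMod 7)) =
    pentagonalSeries (ZMod 7) ^ 2 := by rw [hφ, mul_comm]
  obtain ⟨H, hH, hF⟩ := theta_sixth_sub (constantCoeff_pentagonalSeries _)
    (coeff_one_pentagonalSeries _) theta_theta_theta_pentagonalSeries
    theta_theta_theta_pentagonalSeries_pow_three rfl hφ (theta_theta_theta_of_mul_eq hφ)
    mk_cubicPartition_mul
  have h := congrArg (coeff (7 * (7 * n + 5))) hF
  have h7 : ((7 * (7 * n + 5) : ℕ) : ZMod 7) = 0 :=
    (ZMod.natCast_eq_zero_iff _ 7).mpr (Dvd.intro _ rfl)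
  have hm : ((7 * n + 5 : ℕ) : ZMod 7) ^ 3 ≠ 1 := by
    push_cast
    rw [show (7 : ZMod 7) = 0 from rfl, zero_mul, zero_add]
    decide
  rw [map_sub, coeff_theta, h7, zero_mul, sub_zero, ← expand_seven, coeff_expand_mul,
    coeff_eq_zero_of_theta_theta_theta hH hm, show 7 * (7 * n + 5) = 49 * n + 29 + 6 by ring,
    coeff_X_pow_mul, coeff_mk] at h
  exact (ZMod.natCast_eq_zero_iff _ 7).mp h
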